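/- arXiv:1610.07295 — 2 statements merged into one kernel-verified Lean document; each statement's English description precedes it below -/
import Mathlib

section
/- Let U ⊆ ℂⁿ be open, f : U → ℂ holomorphic, and x ∈ U with f(x) = 0 and with the germ of f at x nonzero. Then for every real α > 0: α is a jumping coefficient of f at x if and only if α + 1 is a jumping coefficient of f at x. Consequently the set of jumping coefficients of f at x equals the set of jumping coefficients lying in (0,1], translated by arbitrary nonnegative integers. -/
open MeasureTheory Filter Topology

noncomputable section

variable {E : Type*} [NormedAddCommGroup E] [NormedSpace ℂ E] [MeasureSpace E]

/-- `g` is holomorphic on some open neighborhood of `x`. -/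
def HolNear (g : E → ℂ) (x : E) : Prop :=
  ∃ W : Set E, IsOpen W ∧ x ∈ W ∧ DifferentiableOn ℂ g W

/-- `g` satisfies the multiplier condition for `(f, α)` at `x`, where `U` is the domain of the
holomorphic function `f`: on some open neighborhood `V ∋ x` contained in the domains of `f` and
`g`, the function `|g|²/|f|^{2α}` is Lebesgue integrable. -/
def MultCond (f : E → ℂ) (U : Set E) (g : E → ℂ) (x : E) (α : ℝ) : Prop :=
  ∃ V : Set E, IsOpen V ∧ x ∈ V ∧ V ⊆ U ∧ DifferentiableOn ℂ g V ∧
    IntegrableOn (fun y => ‖g y‖ ^ 2 / ‖f y‖ ^ (2 * α)) V volume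

/-- `α` is a jumping coefficient of `f` at `x`. -/
def JumpCoeff (f : E → ℂ) (U : Set E) (x : E) (α : ℝ) : Prop :=
  ∃ g : E → ℂ, HolNear g x ∧ (∀ α' : ℝ, α' < α → MultCond f U g x α') ∧ ¬ MultCond f U g x α

/-- the log canonical threshold of `f` at `x`. -/
def Lct (f : E → ℂ) (U : Set E) (x : E) : ℝ :=
  sSup {α : ℝ | 0 ≤ α ∧ MultCond f U (fun _ => 1) x α}


section LineAverage

open Metric

variable {X : Type*} [NormedAddCommGroup X] [NormedSpace ℂ X]

/-- The average of a holomorphic function over circles of fixed radius in a fixed complex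
direction depends holomorphically on the center of the circle. -/
theorem differentiableAt_circleAverage_add_smul [FiniteDimensional ℂ X] {q : X → ℂ} {Ω : Set X}
    (hΩ : IsOpen Ω) (hq : DifferentiableOn ℂ q Ω) {z v : X} {r : ℝ}
    (hz : ∀ w ∈ sphere (0 : ℂ) |r|, z + w • v ∈ Ω) :
    DifferentiableAt ℂ (fun y => Real.circleAverage (fun w => q (y + w • v)) 0 r) z := by
  let _ : MeasurableSpace X := borel X
  have : BorelSpace X := ⟨rfl⟩
  have : ProperSpace X := FiniteDimensional.proper ℂ X
  set c : ℝ → X := fun θ => circleMap 0 r θ • v with hc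
  have hcc : Continuous c := by fun_prop
  have hK : IsCompact ((fun w : ℂ => z + w • v) '' sphere 0 |r|) :=
    (isCompact_sphere _ _).image (by fun_prop)
  obtain ⟨δ, hδ, hδΩ⟩ := hK.exists_cthickening_subset_open hΩ
    (by rintro _ ⟨w, hw, rfl⟩; exact hz w hw)
  obtain ⟨M, hM⟩ := (hK.cthickening (r := δ)).exists_bound_of_continuousOn
    (hq.continuousOn.mono hδΩ)
  have hball : ∀ θ, ∀ y ∈ ball (z + c θ) δ, y ∈ cthickening δ
      ((fun w : ℂ => z + w • v) '' sphere 0 |r|) := fun θ y hy =>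
    mem_cthickening_of_dist_le y _ δ _ ⟨_, circleMap_mem_sphere' 0 r θ, rfl⟩ (mem_ball.1 hy).le
  have hmem : ∀ θ, ∀ y ∈ ball z δ, y + c θ ∈ ball (z + c θ) δ := by
    intro θ y hy
    simpa [mem_ball, dist_eq_norm] using hy
  have hcont : ∀ y ∈ ball z δ, Continuous fun θ => q (y + c θ) := by
    intro y hy
    refine hq.continuousOn.comp_continuous (by fun_prop) fun θ => ?_
    exact hδΩ (hball θ _ (hmem θ y hy))
  have hlip : ∀ θ, LipschitzOnWith (Real.nnabs (2 * M / (δ / 2))) (fun y => q (y + c θ))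
      (ball z (δ / 4)) := by
    intro θ
    refine LipschitzOnWith.of_dist_le_mul fun a ha b hb => ?_
    have hsub : ball (b + c θ) (δ / 2) ⊆ ball (z + c θ) δ := by
      refine ball_subset_ball' ?_
      rw [dist_add_right]
      linarith [mem_ball.1 hb]
    have hM' : ∀ y ∈ ball (b + c θ) (δ / 2), ‖q y‖ ≤ M := fun y hy => hM y (hball θ y (hsub hy))
    have hab : a + c θ ∈ ball (b + c θ) (δ / 2) := by
      rw [mem_ball, dist_add_right]
      linarith [dist_triangle_right a b z, mem_ball.1 ha, mem_ball.1 hb]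
    have hM0 : 0 ≤ M := (norm_nonneg _).trans (hM' _ hab)
    have := Complex.dist_le_div_mul_dist_of_mapsTo_ball (R₂ := 2 * M)
      (hq.mono fun y hy => hδΩ (hball θ y (hsub hy))) (fun y hy => ?_) hab
    · rwa [dist_add_right, ← abs_of_nonneg (by positivity : 0 ≤ 2 * M / (δ / 2)),
        ← Real.coe_nnabs] at this
    · rw [mem_closedBall, dist_eq_norm]
      linarith [norm_sub_le (q y) (q (b + c θ)), hM' y hy,
        hM' _ (mem_ball_self (by positivity : 0 < δ / 2))]
  have key := intervalIntegral.hasFDerivAt_integral_of_dominated_loc_of_lip (𝕜 := ℂ)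
    (μ := volume) (a := 0) (b := 2 * Real.pi)
    (F := fun y θ => q (y + c θ)) (F' := fun θ => fderiv ℂ q (z + c θ)) (x₀ := z)
    (bound := fun _ => 2 * M / (δ / 2))
    (ball_mem_nhds z (by positivity : 0 < δ / 4))
    (by
      filter_upwards [ball_mem_nhds z hδ] with y hy
      exact (hcont y hy).aestronglyMeasurable)
    ((hcont z (mem_ball_self hδ)).intervalIntegrable _ _)
    (by
      refine Measurable.aestronglyMeasurable ?_
      exact (measurable_fderiv ℂ q).comp (by fun_prop))
    (ae_of_all _ fun θ _ => hlip θ)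
    intervalIntegrable_const
    (ae_of_all _ fun θ _ => by
      have h1 := (hq.differentiableAt (hΩ.mem_nhds (hz _ (circleMap_mem_sphere' 0 r θ)))).hasFDerivAt
      exact (hasFDerivAt_comp_add_right (c θ)).2 h1)
  exact key.2.differentiableAt.const_smul ((2 * Real.pi)⁻¹ : ℝ)

end LineAverage

section OneVariable

open Metric

theorem not_integrableOn_ball_inv_norm_sq {R : ℝ} (hR : 0 < R) :
    ¬ IntegrableOn (fun w : ℂ => (‖w‖ ^ 2)⁻¹) (ball 0 R) := by
  intro h
  rw [integrableOn_fun_norm_addHaar (μ := volume) (E := ℂ) (f := fun y : ℝ => (y ^ 2)⁻¹)] at h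
  have h' : IntegrableOn (fun y : ℝ => y⁻¹) (Set.Ioo 0 R) := by
    refine h.congr_fun (fun y hy => ?_) measurableSet_Ioo
    have := hy.1.ne'
    simp [Complex.finrank_real_complex]
    field_simp
  have h2 : IntervalIntegrable (fun y : ℝ => y⁻¹) volume 0 R := by
    rwa [intervalIntegrable_iff_integrableOn_Ioo_of_le hR.le]
  rw [intervalIntegrable_inv_iff] at h2
  rcases h2 with h2 | h2
  · exact hR.ne h2
  · exact h2 (by simp)

/-- A meromorphic function which is square integrable near a point has no pole there. -/
theorem MeromorphicAt.meromorphicOrderAt_nonneg_of_integrableOn {Q : ℂ → ℂ} {p : ℂ}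
    (hQ : MeromorphicAt Q p) {s : Set ℂ} (hs : s ∈ 𝓝 p)
    (hint : IntegrableOn (fun w => ‖Q w‖ ^ 2) s) : 0 ≤ meromorphicOrderAt Q p := by
  by_contra! hlt
  obtain ⟨k, hk⟩ := WithTop.ne_top_iff_exists.1 (ne_top_of_lt hlt)
  obtain ⟨g, hg, hg0, hgQ⟩ := (meromorphicOrderAt_eq_int_iff hQ).1 hk.symm
  have hk1 : k ≤ -1 := by
    rw [← hk] at hlt
    have : k < 0 := by exact_mod_cast hlt
    omega
  have hgp : 0 < ‖g p‖ := norm_pos_iff.2 hg0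
  have hgc : ∀ᶠ w in 𝓝 p, ‖g p‖ / 2 < ‖g w‖ :=
    hg.continuousAt.norm.eventually (lt_mem_nhds (half_lt_self hgp))
  rw [eventually_nhdsWithin_iff] at hgQ
  obtain ⟨R, hR, hball⟩ := Metric.eventually_nhds_iff_ball.1
    ((hgQ.and hgc).and (Filter.Eventually.and hs (ball_mem_nhds p one_pos)))
  have hbd : ∀ w ∈ ball p R, (‖w - p‖ ^ 2)⁻¹ ≤ (‖g p‖ / 2)⁻¹ ^ 2 * ‖Q w‖ ^ 2 := by
    intro w hw
    obtain ⟨⟨h1, h2⟩, -, h3⟩ := hball w hw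
    rcases eq_or_ne w p with rfl | hne
    · simp; positivity
    rw [← inv_pow, ← mul_pow]
    have hpos : 0 < ‖w - p‖ := norm_pos_iff.2 (sub_ne_zero.2 hne)
    have hle : ‖w - p‖⁻¹ ≤ ‖w - p‖ ^ k := by
      rw [← zpow_neg_one]
      refine zpow_le_zpow_right_of_le_one₀ hpos ?_ hk1
      exact (mem_ball_iff_norm.1 h3).le
    refine pow_le_pow_left₀ (by positivity) ?_ 2
    rw [h1 hne, norm_smul, norm_zpow]
    calc ‖w - p‖⁻¹ ≤ ‖w - p‖ ^ k := hle
      _ = (‖g p‖ / 2)⁻¹ * (‖w - p‖ ^ k * (‖g p‖ / 2)) := by field_simp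
      _ ≤ _ := by gcongr
  have hI : IntegrableOn (fun w : ℂ => (‖w - p‖ ^ 2)⁻¹) (ball p R) := by
    refine Integrable.mono' ((hint.mono_set fun w hw => (hball w hw).2.1).const_mul
      ((‖g p‖ / 2)⁻¹ ^ 2)) ?_ ?_
    · exact Measurable.aestronglyMeasurable (by fun_prop)
    · filter_upwards [ae_restrict_mem measurableSet_ball] with w hw
      rw [Real.norm_of_nonneg (by positivity)]
      exact hbd w hw
  refine not_integrableOn_ball_inv_norm_sq hR ?_
  have hpre : (fun w : ℂ => w + p) ⁻¹' ball p R = ball 0 R := by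
    ext w; simp
  have := (measurePreserving_add_right (volume : Measure ℂ) p).integrableOn_comp_preimage
    (measurableEmbedding_addRight p) (f := fun w : ℂ => (‖w - p‖ ^ 2)⁻¹) (s := ball p R)
  rw [hpre] at this
  simpa [Function.comp_def] using this.2 hI

/-- If `G / F` is square integrable on a disc and `F` has no zero on a smaller circle, then the
mean of `G / F` over the circle computes the quotient of `G` by `F` at the center. -/
theorem mul_circleAverage_div_eq {F G : ℂ → ℂ} {r R : ℝ} (hr : 0 < r) (hrR : r < R)
    (hF : DifferentiableOn ℂ F (ball 0 R)) (hG : DifferentiableOn ℂ G (ball 0 R))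
    (hF0 : ∀ w ∈ sphere (0 : ℂ) r, F w ≠ 0)
    (hint : IntegrableOn (fun w => ‖G w‖ ^ 2 / ‖F w‖ ^ 2) (ball 0 R)) :
    F 0 * Real.circleAverage (fun w => G w / F w) 0 r = G 0 := by
  have hFa : AnalyticOnNhd ℂ F (ball 0 R) := hF.analyticOnNhd isOpen_ball
  have hGa : AnalyticOnNhd ℂ G (ball 0 R) := hG.analyticOnNhd isOpen_ball
  have hsub : closedBall (0 : ℂ) r ⊆ ball 0 R := closedBall_subset_ball hrR
  have hQ : MeromorphicOn (G / F) (ball 0 R) := fun w hw =>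
    (hGa w hw).meromorphicAt.div (hFa w hw).meromorphicAt
  have hFne : ∀ p ∈ ball (0 : ℂ) R, ∀ᶠ w in 𝓝[≠] p, F w ≠ 0 := by
    intro p hp
    refine (hFa p hp).eventually_eq_zero_or_eventually_ne_zero.resolve_left fun h => ?_
    have hrs : (r : ℂ) ∈ sphere (0 : ℂ) r := by simp [abs_of_pos hr]
    exact hF0 r hrs (hFa.eqOn_zero_of_preconnected_of_eventuallyEq_zero
      (convex_ball _ _).isPreconnected hp h (hsub (sphere_subset_closedBall hrs)))
  set H := toMeromorphicNFOn (G / F) (ball 0 R) with hH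
  have hHa : AnalyticOnNhd ℂ H (ball 0 R) := by
    intro p hp
    rw [← (meromorphicNFOn_toMeromorphicNFOn (G / F) _ hp).meromorphicOrderAt_nonneg_iff_analyticAt,
      meromorphicOrderAt_toMeromorphicNFOn hQ hp]
    refine (hQ p hp).meromorphicOrderAt_nonneg_of_integrableOn (isOpen_ball.mem_nhds hp) ?_
    simpa [div_pow] using hint
  have hmul : ∀ p ∈ ball (0 : ℂ) R, F p * H p = G p := by
    intro p hp
    have h1 : F * H =ᶠ[𝓝[≠] p] G := by
      filter_upwards [hFne p hp, hQ.toMeromorphicNFOn_eq_self_on_nhdsNE hp] with w hw hw'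
      rw [Pi.mul_apply, hH, hw', Pi.div_apply, mul_div_cancel₀ _ hw]
    exact tendsto_nhds_unique_of_eventuallyEq
      ((hFa p hp).mul (hHa p hp)).continuousAt.continuousWithinAt
      (hGa p hp).continuousAt.continuousWithinAt h1
  have havg : Real.circleAverage (fun w => G w / F w) 0 r = Real.circleAverage H 0 r := by
    refine Real.circleAverage_congr_sphere fun w hw => ?_
    rw [abs_of_pos hr] at hw
    show G w / F w = H w
    rw [← hmul w (hsub (sphere_subset_closedBall hw)), mul_div_cancel_left₀ _ (hF0 w hw)]
  have hHd : DiffContOnCl ℂ H (ball 0 |r|) := by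
    rw [abs_of_pos hr]
    exact (hHa.differentiableOn.mono hsub).diffContOnCl_ball subset_rfl
  rw [havg, hHd.circleAverage, hmul 0 (mem_ball_self (hr.trans hrR))]

end OneVariable

section Division

open Metric

variable {X : Type*} [NormedAddCommGroup X] [NormedSpace ℂ X] [FiniteDimensional ℂ X]
  [MeasurableSpace X] [BorelSpace X] (μ : Measure X) [μ.IsAddHaarMeasure]

/-- The restrictions of an integrable function to almost all discs of fixed radius in a fixed
complex direction are integrable. -/
theorem ae_integrableOn_add_smul {V : Set X} (hV : MeasurableSet V) {P : X → ℝ}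
    (hP : IntegrableOn P V μ) (v : X) {R : ℝ} {S : Set X}
    (hS : ∀ z ∈ S, ∀ w ∈ ball (0 : ℂ) R, z + w • v ∈ V) :
    ∀ᵐ z ∂μ, z ∈ S → IntegrableOn (fun w => P (z + w • v)) (ball (0 : ℂ) R) := by
  have : ProperSpace X := FiniteDimensional.proper ℂ X
  have : Fact (volume (ball (0 : ℂ) R) < ⊤) := ⟨measure_ball_lt_top⟩
  have mp : MeasurePreserving (fun p : ℂ × X => (p.1, p.2 + p.1 • v))
      ((volume.restrict (ball (0 : ℂ) R)).prod μ) ((volume.restrict (ball (0 : ℂ) R)).prod μ) :=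
    (MeasurePreserving.id _).skew_product (g := fun (w : ℂ) z => z + w • v)
      (Continuous.measurable (by fun_prop))
      (ae_of_all _ fun w => map_add_right_eq_self μ (w • v))
  have hI : Integrable (V.indicator P) μ := (integrable_indicator_iff hV).2 hP
  have := (mp.integrable_comp_of_integrable (hI.comp_snd _)).prod_left_ae
  filter_upwards [this] with z hz hzS
  refine Integrable.congr hz ?_
  filter_upwards [ae_restrict_mem measurableSet_ball] with w hw
  simp [hS z hzS w hw]

/-- If `g / f` is square integrable, then the holomorphic function `f` divides `g` locally. -/
theorem exists_mul_eq_of_integrableOn_div {V : Set X} (hV : IsOpen V) {f g : X → ℂ}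
    (hf : DifferentiableOn ℂ f V) (hg : DifferentiableOn ℂ g V) {x : X} (hx : x ∈ V)
    (hne : ¬ f =ᶠ[𝓝 x] 0) (hint : IntegrableOn (fun y => ‖g y‖ ^ 2 / ‖f y‖ ^ 2) V μ) :
    ∃ (N : Set X) (h : X → ℂ), IsOpen N ∧ x ∈ N ∧ N ⊆ V ∧ DifferentiableOn ℂ h N ∧
      ∀ y ∈ N, f y * h y = g y := by
  obtain ⟨ε, hε, hεV⟩ := Metric.isOpen_iff.1 hV x hx
  obtain ⟨z₀, hz₀, hfz₀⟩ : ∃ z₀ ∈ ball x ε, f z₀ ≠ 0 := by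
    by_contra! h
    exact hne (Filter.mem_of_superset (ball_mem_nhds x hε) h)
  set v := z₀ - x with hv
  have hline : Differentiable ℂ fun w : ℂ => x + w • v := by fun_prop
  have hT : Convex ℝ ((fun w : ℂ => w • v) ⁻¹' ball 0 ε) :=
    (convex_ball 0 ε).is_linear_preimage
      ((LinearMap.toSpanSingleton ℂ X v).restrictScalars ℝ).isLinear
  have hTo : IsOpen ((fun w : ℂ => w • v) ⁻¹' ball 0 ε) := isOpen_ball.preimage (by fun_prop)
  have hfa : AnalyticOnNhd ℂ (fun w : ℂ => f (x + w • v)) ((fun w : ℂ => w • v) ⁻¹' ball 0 ε) := by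
    refine DifferentiableOn.analyticOnNhd ?_ hTo
    refine hf.comp hline.differentiableOn fun w hw => hεV ?_
    simpa [mem_ball_iff_norm] using hw
  have hne0 : ∀ᶠ w in 𝓝[≠] (0 : ℂ), f (x + w • v) ≠ 0 := by
    have h0 : (0 : ℂ) ∈ (fun w : ℂ => w • v) ⁻¹' ball 0 ε := by simpa using hε
    refine (hfa 0 h0).eventually_eq_zero_or_eventually_ne_zero.resolve_left fun h => hfz₀ ?_
    have h1 : (1 : ℂ) ∈ (fun w : ℂ => w • v) ⁻¹' ball 0 ε := by
      simpa [hv, dist_eq_norm] using hz₀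
    simpa [hv] using hfa.eqOn_zero_of_preconnected_of_eventuallyEq_zero hT.isPreconnected h0 h h1
  rw [eventually_nhdsWithin_iff] at hne0
  obtain ⟨δ₀, hδ₀, hδ₀f⟩ := Metric.eventually_nhds_iff_ball.1 hne0
  have hcont : Continuous fun p : X × ℂ => p.1 + p.2 • v := by fun_prop
  obtain ⟨δ, hδ, hδV⟩ := Metric.eventually_nhds_iff_ball.1
    (hcont.continuousAt.eventually_mem (x := (x, (0 : ℂ))) (by simpa using hV.mem_nhds hx))
  have hδV' : ∀ z ∈ ball x δ, ∀ w ∈ ball (0 : ℂ) δ, z + w • v ∈ V := fun z hz w hw =>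
    hδV (z, w) (by rw [← ball_prod_same]; exact ⟨hz, hw⟩)
  set R := min δ δ₀ with hR
  have hRpos : 0 < R := lt_min hδ hδ₀
  set r := R / 2 with hr
  have hrpos : 0 < r := half_pos hRpos
  have hrR : r < R := half_lt_self hRpos
  set Ω := V ∩ f ⁻¹' {0}ᶜ with hΩ
  have hΩo : IsOpen Ω := hf.continuousOn.isOpen_inter_preimage hV isOpen_compl_singleton
  have hxΩ : ∀ w ∈ sphere (0 : ℂ) r, x + w • v ∈ Ω := by
    intro w hw
    have hwR : w ∈ ball (0 : ℂ) R := sphere_subset_closedBall.trans (closedBall_subset_ball hrR) hw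
    refine ⟨hδV' x (mem_ball_self hδ) w (ball_subset_ball (min_le_left _ _) hwR),
      hδ₀f w (ball_subset_ball (min_le_right _ _) hwR) ?_⟩
    exact ne_of_mem_sphere hw hrpos.ne'
  have hev : ∀ᶠ z in 𝓝 x, ∀ w ∈ sphere (0 : ℂ) r, z + w • v ∈ Ω :=
    (isCompact_sphere _ _).eventually_forall_of_forall_eventually fun w hw =>
      hcont.continuousAt.eventually_mem (x := (x, w)) (hΩo.mem_nhds (hxΩ w hw))
  obtain ⟨η, hη, hηΩ⟩ := Metric.eventually_nhds_iff_ball.1 (hev.and (ball_mem_nhds x hδ))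
  have hdiff : DifferentiableOn ℂ
      (fun y => Real.circleAverage (fun w => g (y + w • v) / f (y + w • v)) 0 r) (ball x η) := by
    intro z hz
    refine (differentiableAt_circleAverage_add_smul (q := fun y => g y / f y) hΩo ?_
      ?_).differentiableWithinAt
    · simp only [div_eq_mul_inv]
      exact (hg.mono Set.inter_subset_left).mul
        ((hf.mono Set.inter_subset_left).inv fun y hy => hy.2)
    · rw [abs_of_pos hrpos]
      exact (hηΩ z hz).1
  have hsub : ball x η ⊆ V := fun z hz => by
    simpa using hδV' z (hηΩ z hz).2 0 (mem_ball_self hδ)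
  refine ⟨ball x η, _, isOpen_ball, mem_ball_self hη, hsub, hdiff, ?_⟩
  have hS : ∀ z ∈ ball x η, ∀ w ∈ ball (0 : ℂ) R, z + w • v ∈ V := fun z hz w hw =>
    hδV' z (hηΩ z hz).2 w (ball_subset_ball (min_le_left _ _) hw)
  refine Measure.eqOn_open_of_ae_eq (μ := μ) ?_ isOpen_ball
    ((hf.mono hsub).mul hdiff).continuousOn (hg.mono hsub).continuousOn
  rw [EventuallyEq, ae_restrict_iff' measurableSet_ball]
  filter_upwards [ae_integrableOn_add_smul μ hV.measurableSet hint v hS] with z hz hzη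
  have hmaps : Set.MapsTo (fun w : ℂ => z + w • v) (ball 0 R) V := hS z hzη
  have hzline : Differentiable ℂ fun w : ℂ => z + w • v := by fun_prop
  have := mul_circleAverage_div_eq hrpos hrR (hf.comp hzline.differentiableOn hmaps)
    (hg.comp hzline.differentiableOn hmaps) (fun w hw => ((hηΩ z hzη).1 w hw).2) (hz hzη)
  simpa using this

end Division

section Multiplier

variable {X : Type*} [NormedAddCommGroup X] [NormedSpace ℂ X] [MeasureSpace X]
  {f g h : X → ℂ} {U : Set X} {x : X} {α : ℝ}

theorem norm_mul_sq_div_rpow_of_ne_zero {a : ℂ} (ha : a ≠ 0) (b : ℂ) (α : ℝ) :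
    ‖a * b‖ ^ 2 / ‖a‖ ^ (2 * (α + 1)) = ‖b‖ ^ 2 / ‖a‖ ^ (2 * α) := by
  have ha' : 0 < ‖a‖ := norm_pos_iff.2 ha
  rw [mul_add, Real.rpow_add ha', mul_one, Real.rpow_two, norm_mul, mul_pow]
  field_simp

theorem norm_mul_sq_div_rpow (a b : ℂ) (hα : 0 < α) :
    ‖a * b‖ ^ 2 / ‖a‖ ^ (2 * (α + 1)) = ‖b‖ ^ 2 / ‖a‖ ^ (2 * α) := by
  rcases eq_or_ne a 0 with rfl | ha
  · have hα' : 2 * α ≠ 0 := by positivity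
    simp [Real.zero_rpow hα']
  · exact norm_mul_sq_div_rpow_of_ne_zero ha b α

theorem norm_mul_sq_div_rpow_le (a b : ℂ) (α : ℝ) :
    ‖a * b‖ ^ 2 / ‖a‖ ^ (2 * (α + 1)) ≤ ‖b‖ ^ 2 / ‖a‖ ^ (2 * α) := by
  rcases eq_or_ne a 0 with rfl | ha
  · simp only [zero_mul, norm_zero, ne_eq, OfNat.ofNat_ne_zero, not_false_eq_true, zero_pow,
      zero_div]
    positivity
  · exact (norm_mul_sq_div_rpow_of_ne_zero ha b α).le

theorem multCond_of_nonpos [BorelSpace X] [SecondCountableTopologyEither X ℝ]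
    [IsLocallyFiniteMeasure (volume : Measure X)]
    (hU : IsOpen U) (hf : DifferentiableOn ℂ f U) (hx : x ∈ U) (hg : HolNear g x) (hα : α ≤ 0) :
    MultCond f U g x α := by
  obtain ⟨W, hW, hxW, hgW⟩ := hg
  have hcont : ContinuousOn (fun y => ‖g y‖ ^ 2 / ‖f y‖ ^ (2 * α)) (U ∩ W) := by
    have : (fun y => ‖g y‖ ^ 2 / ‖f y‖ ^ (2 * α)) =
        fun y => ‖g y‖ ^ 2 * ‖f y‖ ^ (-(2 * α)) := by
      funext y
      rw [Real.rpow_neg (norm_nonneg _), div_eq_mul_inv]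
    rw [this]
    refine ((hgW.continuousOn.mono Set.inter_subset_right).norm.pow 2).mul
      ((hf.continuousOn.mono Set.inter_subset_left).norm.rpow_const fun y _ => Or.inr ?_)
    linarith
  have hUW : IsOpen (U ∩ W) := hU.inter hW
  have hint := hcont.integrableAt_nhdsWithin (μ := volume) hUW.measurableSet ⟨hx, hxW⟩
  rw [hUW.nhdsWithin_eq ⟨hx, hxW⟩] at hint
  obtain ⟨s, hs, hint⟩ := hint
  obtain ⟨t, hts, ht, hxt⟩ := mem_nhds_iff.1 hs
  exact ⟨t ∩ (U ∩ W), ht.inter hUW, ⟨hxt, hx, hxW⟩, fun y hy => hy.2.1,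
    hgW.mono fun y hy => hy.2.2, hint.mono_set fun y hy => hts hy.1⟩

theorem multCond_mul_iff (hf : DifferentiableOn ℂ f U) (hg : HolNear g x) (hα : 0 < α) :
    MultCond f U (fun y => f y * g y) x (α + 1) ↔ MultCond f U g x α := by
  obtain ⟨W, hW, hxW, hgW⟩ := hg
  simp only [MultCond, norm_mul_sq_div_rpow _ _ hα]
  constructor
  · rintro ⟨V, hV, hxV, hVU, -, hint⟩
    exact ⟨V ∩ W, hV.inter hW, ⟨hxV, hxW⟩, fun y hy => hVU hy.1,
      hgW.mono Set.inter_subset_right, hint.mono_set Set.inter_subset_left⟩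
  · rintro ⟨V, hV, hxV, hVU, hgV, hint⟩
    exact ⟨V, hV, hxV, hVU, (hf.mono hVU).mul hgV, hint⟩

theorem MultCond.congr [OpensMeasurableSpace X] (hgh : g =ᶠ[𝓝 x] h)
    (hg : MultCond f U g x α) : MultCond f U h x α := by
  obtain ⟨V, hV, hxV, hVU, hgV, hint⟩ := hg
  obtain ⟨t, hts, ht, hxt⟩ := mem_nhds_iff.1 hgh
  have heq : ∀ y ∈ V ∩ t, g y = h y := fun y hy => hts hy.2
  refine ⟨V ∩ t, hV.inter ht, ⟨hxV, hxt⟩, fun y hy => hVU hy.1,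
    (hgV.mono Set.inter_subset_left).congr fun y hy => (heq y hy).symm, ?_⟩
  refine (hint.mono_set Set.inter_subset_left).congr ?_
  filter_upwards [ae_restrict_mem (hV.inter ht).measurableSet] with y hy
  rw [heq y hy]

theorem MultCond.mul_left [OpensMeasurableSpace X] [SecondCountableTopologyEither X ℝ]
    (hf : DifferentiableOn ℂ f U) (hg : MultCond f U g x α) :
    MultCond f U (fun y => f y * g y) x (α + 1) := by
  obtain ⟨V, hV, hxV, hVU, hgV, hint⟩ := hg
  have hfgV : DifferentiableOn ℂ (fun y => f y * g y) V := (hf.mono hVU).mul hgV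
  have hmeas {u : X → ℂ} (hu : DifferentiableOn ℂ u V) :
      AEMeasurable (fun y => ‖u y‖) (volume.restrict V) :=
    (hu.continuousOn.norm.aestronglyMeasurable hV.measurableSet).aemeasurable
  refine ⟨V, hV, hxV, hVU, hfgV, Integrable.mono' hint ?_ (ae_of_all _ fun y => ?_)⟩
  · exact (((hmeas hfgV).pow_const 2).div
      ((hmeas (hf.mono hVU)).pow_const _)).aestronglyMeasurable
  · rw [Real.norm_of_nonneg (by positivity)]
    exact norm_mul_sq_div_rpow_le _ _ _

theorem JumpCoeff.add_one [OpensMeasurableSpace X] [SecondCountableTopologyEither X ℝ]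
    (hU : IsOpen U) (hf : DifferentiableOn ℂ f U) (hx : x ∈ U) (hα : 0 < α)
    (h : JumpCoeff f U x α) : JumpCoeff f U x (α + 1) := by
  obtain ⟨g, hg, hlt, hnot⟩ := h
  have hfg : HolNear (fun y => f y * g y) x := by
    obtain ⟨W, hW, hxW, hgW⟩ := hg
    exact ⟨U ∩ W, hU.inter hW, ⟨hx, hxW⟩, (hf.mono Set.inter_subset_left).mul
      (hgW.mono Set.inter_subset_right)⟩
  refine ⟨_, hfg, fun α' hα' => ?_, fun h => hnot ((multCond_mul_iff hf hg hα).1 h)⟩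
  simpa using (hlt (α' - 1) (by linarith)).mul_left hf

theorem JumpCoeff.of_add_one [FiniteDimensional ℂ X] [BorelSpace X]
    [(volume : Measure X).IsAddHaarMeasure] (hU : IsOpen U) (hf : DifferentiableOn ℂ f U) (hx : x ∈ U)
    (hne : ¬ f =ᶠ[𝓝 x] 0) (hα : 0 < α) (h : JumpCoeff f U x (α + 1)) : JumpCoeff f U x α := by
  have : ProperSpace X := FiniteDimensional.proper ℂ X
  obtain ⟨g, -, hlt, hnot⟩ := h
  obtain ⟨V, hV, hxV, hVU, hgV, hint⟩ := hlt 1 (by linarith)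
  simp only [mul_one, Real.rpow_two] at hint
  obtain ⟨N, q, hN, hxN, -, hq, hmul⟩ :=
    exists_mul_eq_of_integrableOn_div volume hV (hf.mono hVU) hgV hxV hne hint
  have hqx : HolNear q x := ⟨N, hN, hxN, hq⟩
  have hev : (fun y => f y * q y) =ᶠ[𝓝 x] g := Filter.mem_of_superset (hN.mem_nhds hxN) hmul
  refine ⟨q, hqx, fun α' hα' => ?_,
    fun h => hnot (((multCond_mul_iff hf hqx hα).2 h).congr hev)⟩
  rcases le_or_gt α' 0 with h0 | h0
  · exact multCond_of_nonpos hU hf hx hqx h0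
  · exact (multCond_mul_iff hf hqx h0).1 ((hlt (α' + 1) (by linarith)).congr hev.symm)

end Multiplier

/-- Germ-level version of (2.1.5): for `α > 0`, `α` is a jumping coefficient of `f` at `x`
iff `α + 1` is; consequently `JC(f,x) = (JC(f,x) ∩ (0,1]) + ℕ`. -/
theorem jumpCoeff_periodicity
    {n : ℕ} (hn : 1 ≤ n)
    (U : Set (Fin n → ℂ)) (hU : IsOpen U)
    (f : (Fin n → ℂ) → ℂ) (hf : DifferentiableOn ℂ f U)
    (x : Fin n → ℂ) (hx : x ∈ U) (hf0 : f x = 0) (hne : ¬ (f =ᶠ[𝓝 x] 0)) :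
    (∀ α : ℝ, 0 < α → (JumpCoeff f U x α ↔ JumpCoeff f U x (α + 1))) ∧
    {α : ℝ | 0 < α ∧ JumpCoeff f U x α} =
      {α : ℝ | ∃ (β : ℝ) (k : ℕ), 0 < β ∧ β ≤ 1 ∧ JumpCoeff f U x β ∧ α = β + k} := by
  have key : ∀ α : ℝ, 0 < α → (JumpCoeff f U x α ↔ JumpCoeff f U x (α + 1)) := fun α hα =>
    ⟨fun h => h.add_one hU hf hx hα, fun h => h.of_add_one hU hf hx hne hα⟩
  refine ⟨key, Set.ext fun α => ⟨?_, ?_⟩⟩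
  · rintro ⟨hα, h⟩
    obtain ⟨m, hm⟩ := exists_nat_ge α
    induction m generalizing α with
    | zero => exact absurd hα (not_lt.2 (by simpa using hm))
    | succ m ih =>
      rcases le_or_gt α 1 with h1 | h1
      · exact ⟨α, 0, hα, h1, h, by simp⟩
      · have hα' : 0 < α - 1 := by linarith
        obtain ⟨β, k, hβ, hβ1, hj, hk⟩ := ih (α - 1) hα'
          ((key _ hα').2 (by simpa using h)) (by push_cast at hm; linarith)
        exact ⟨β, k + 1, hβ, hβ1, hj, by push_cast; linarith⟩
  · rintro ⟨β, k, hβ, -, hj, rfl⟩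
    refine ⟨by positivity, ?_⟩
    induction k with
    | zero => simpa using hj
    | succ k ih =>
      have := (key (β + k) (by positivity)).1 ih
      rwa [Nat.cast_succ, ← add_assoc]
end
end

section
/- Let d ≥ 1 and let m₁, …, m_d be integers with m_j ≥ 2, and set f(z) = z₁^{m₁} + ⋯ + z_d^{m_d} on ℂ^d. Then the log canonical threshold of f at the origin equals min{1, Σ_{j=1}^d 1/m_j}. Explicitly: the function z ↦ |f(z)|^{−2α} is integrable on some neighborhood of 0 in ℂ^d if and only if α < min{1, Σ_{j=1}^d 1/m_j} (for α in the range where the threshold is not attained, i.e., the supremum defining the threshold equals min{1, Σ 1/m_j}). -/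
open MeasureTheory Filter Topology

noncomputable section

variable {E : Type*} [NormedAddCommGroup E] [NormedSpace ℂ E] [MeasureSpace E]

lemma exists_root_mul_max_pow_le_norm_pow_sub (n : ℕ) :
    ∃ κ : ℝ, 0 < κ ∧ ∀ a z : ℂ, ∃ b : ℂ, b ^ (n + 1) = a ^ (n + 1) ∧
      κ * ‖z - b‖ * max ‖z - b‖ ‖b‖ ^ n ≤ ‖z ^ (n + 1) - a ^ (n + 1)‖ := by
  obtain ⟨ζ, hζ⟩ : ∃ ζ : ℂ, IsPrimitiveRoot ζ (n + 1) :=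
    ⟨_, Complex.isPrimitiveRoot_exp (n + 1) n.succ_ne_zero⟩
  refine ⟨∏ i ∈ Finset.range n, ‖1 - ζ ^ (i + 1)‖ / 2, Finset.prod_pos fun i hi => ?_,
    fun a z => ?_⟩
  · have : ζ ^ (i + 1) ≠ 1 := hζ.pow_ne_one_of_pos_of_lt (by omega) (by simpa using hi)
    have : 0 < ‖1 - ζ ^ (i + 1)‖ := norm_pos_iff.2 (sub_ne_zero.2 this.symm)
    positivity
  have hroot (i : ℕ) : (ζ ^ i) ^ (n + 1) = 1 := by rw [pow_right_comm, hζ.pow_eq_one, one_pow]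
  obtain ⟨b, hb, hmin⟩ := (Polynomial.nthRootsFinset (n + 1) (a ^ (n + 1))).exists_min_image
    (fun b => ‖z - b‖) ⟨a, by simp [Polynomial.mem_nthRootsFinset]⟩
  rw [Polynomial.mem_nthRootsFinset n.succ_pos] at hb
  refine ⟨b, hb, ?_⟩
  have hfac : z ^ (n + 1) - a ^ (n + 1) = ∏ i ∈ Finset.range (n + 1), (z - ζ ^ i * b) := by
    have := congrArg (Polynomial.eval z) (X_pow_sub_C_eq_prod hζ n.succ_pos hb)
    simpa [Polynomial.eval_prod] using this
  have hmin' (i : ℕ) : ‖z - b‖ ≤ ‖z - ζ ^ i * b‖ := by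
    refine hmin _ ?_
    rw [Polynomial.mem_nthRootsFinset n.succ_pos, mul_pow, hroot, one_mul, hb]
  have hle (i : ℕ) : ‖1 - ζ ^ i‖ / 2 * max ‖z - b‖ ‖b‖ ≤ ‖z - ζ ^ i * b‖ := by
    have h1 : ‖1 - ζ ^ i‖ ≤ 2 := by
      have := norm_sub_le 1 (ζ ^ i)
      rw [norm_pow, hζ.norm'_eq_one n.succ_ne_zero] at this
      norm_num at this
      exact this
    have h2 : ‖1 - ζ ^ i‖ * ‖b‖ ≤ 2 * ‖z - ζ ^ i * b‖ := by
      have := norm_sub_le (z - ζ ^ i * b) (z - b)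
      rw [show z - ζ ^ i * b - (z - b) = (1 - ζ ^ i) * b by ring, norm_mul] at this
      linarith [hmin' i]
    rw [mul_max_of_nonneg _ _ (by positivity)]
    refine max_le ?_ (by linarith)
    nlinarith [hmin' i, norm_nonneg (z - b)]
  rw [hfac, Finset.prod_range_succ', norm_mul, norm_prod, pow_zero, one_mul]
  calc _ = (∏ i ∈ Finset.range n, ‖1 - ζ ^ (i + 1)‖ / 2 * max ‖z - b‖ ‖b‖) * ‖z - b‖ := by
        rw [Finset.prod_mul_distrib, Finset.prod_const, Finset.card_range]; ring
    _ ≤ _ := by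
        gcongr with i
        exact hle _

lemma exists_root_rpow_mul_rpow_le (n : ℕ) {β γ R : ℝ} (hβ : 0 ≤ β) (hβn : β * (n + 1) < 1)
    (hγ : 0 ≤ γ) (hβγ : β + γ < 1) (hR : 1 ≤ R) :
    ∃ K A : ℝ, 0 < K ∧ 0 ≤ A ∧ A < 1 ∧ ∀ c z : ℂ, ‖c‖ ≤ R → ∃ b : ℂ, b ^ (n + 1) = -c ∧
      K * ‖z - b‖ ^ (2 * A) * ‖c‖ ^ (2 * γ) ≤ ‖z ^ (n + 1) + c‖ ^ (2 * (β + γ)) := by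
  obtain ⟨κ, hκ, h⟩ := exists_root_mul_max_pow_le_norm_pow_sub n
  set q : ℝ := max 0 (n * β - γ) with hq
  set p : ℝ := n * (β + γ) - q with hp
  have hq0 : 0 ≤ q := le_max_left _ _
  have hn : (0 : ℝ) ≤ n := n.cast_nonneg
  have hp0 : 0 ≤ p := by
    rw [hp, hq, sub_nonneg]; exact max_le (by positivity) (by nlinarith)
  have hpγ : p ≤ (n + 1) * γ := by
    have := le_max_right 0 (n * β - γ)
    rw [hp]; linarith
  have hR0 : 0 < R := by linarith
  refine ⟨κ ^ (2 * (β + γ)) / R ^ (2 * ((n + 1) * γ - p)), β + γ + q, by positivity,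
    by positivity, ?_, fun c z hc => ?_⟩
  · rcases max_cases 0 (n * β - γ) with h | h <;> rw [hq, h.1] <;> linarith
  obtain ⟨a, ha⟩ := IsAlgClosed.exists_pow_nat_eq (-c) n.succ_pos
  obtain ⟨b, hb, hbz⟩ := h a z
  rw [ha] at hb hbz
  rw [sub_neg_eq_add] at hbz
  refine ⟨b, hb, ?_⟩
  have hbc : ‖c‖ = ‖b‖ ^ ((n : ℝ) + 1) := by
    rw [← norm_neg, ← hb, norm_pow, ← Real.rpow_natCast]; push_cast; rfl
  have hbR : ‖b‖ ≤ R := by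
    by_contra! hlt
    have : ‖b‖ ^ (1 : ℝ) ≤ ‖b‖ ^ ((n : ℝ) + 1) :=
      Real.rpow_le_rpow_of_exponent_le (by linarith) (by linarith)
    rw [Real.rpow_one] at this
    linarith
  set X := ‖z - b‖
  set Y := ‖b‖
  have hX : 0 ≤ X := norm_nonneg _
  have hY : 0 ≤ Y := norm_nonneg _
  have hM : 0 ≤ max X Y := le_max_of_le_left hX
  have hcY : ‖c‖ ^ (2 * γ) ≤ Y ^ (2 * p) * R ^ (2 * ((n + 1) * γ - p)) := by
    rw [hbc, ← Real.rpow_mul hY,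
      show ((n : ℝ) + 1) * (2 * γ) = 2 * p + 2 * ((n + 1) * γ - p) by ring,
      Real.rpow_add_of_nonneg hY (by positivity) (by linarith)]
    gcongr
  calc κ ^ (2 * (β + γ)) / R ^ (2 * ((n + 1) * γ - p)) * X ^ (2 * (β + γ + q)) * ‖c‖ ^ (2 * γ)
      ≤ κ ^ (2 * (β + γ)) / R ^ (2 * ((n + 1) * γ - p)) * X ^ (2 * (β + γ + q)) *
          (Y ^ (2 * p) * R ^ (2 * ((n + 1) * γ - p))) := by gcongr
    _ = κ ^ (2 * (β + γ)) * X ^ (2 * (β + γ)) * (X ^ (2 * q) * Y ^ (2 * p)) := by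
        rw [mul_add 2 (β + γ) q, Real.rpow_add_of_nonneg hX (by positivity) (by positivity)]
        field_simp
    _ ≤ κ ^ (2 * (β + γ)) * X ^ (2 * (β + γ)) * (max X Y ^ (2 * q) * max X Y ^ (2 * p)) := by
        gcongr
        · exact le_max_left _ _
        · exact le_max_right _ _
    _ = (κ * X * max X Y ^ n) ^ (2 * (β + γ)) := by
        rw [Real.mul_rpow (by positivity) (by positivity), Real.mul_rpow hκ.le hX,
          ← Real.rpow_natCast, ← Real.rpow_mul hM,
          ← Real.rpow_add_of_nonneg hM (by positivity) (by positivity)]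
        congr 2
        rw [hp]; ring
    _ ≤ _ := by gcongr

lemma lintegral_ball_enorm_rpow_lt_top {A : ℝ} (hA : A < 1) (r : ℝ) :
    ∫⁻ z in Metric.ball (0 : ℂ) r, ‖z‖ₑ ^ (-(2 * A)) < ⊤ := by
  have hbound : IntegrableOn (fun z : ℂ => ‖z‖ ^ (-(2 * A))) (Metric.ball 0 r) := by
    refine integrableOn_ball_of_norm_le_rpow (C := 1) (α := 2 * A) (by simp) (by simp; linarith)
      (ae_of_all _ fun z => ?_)
      (measurable_norm.pow_const _).aestronglyMeasurable
    rw [one_mul, Real.norm_of_nonneg (by positivity)]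
  refine lt_of_eq_of_lt (setLIntegral_congr_fun_ae measurableSet_ball ?_) hbound.2
  filter_upwards [Measure.ae_ne volume (0 : ℂ)] with z hz _
  rw [Real.enorm_of_nonneg (by positivity),
    ← ENNReal.ofReal_rpow_of_pos (norm_pos_iff.2 hz), ofReal_norm]

lemma exists_setLIntegral_pow_add_le (n : ℕ) {β γ R : ℝ} (hβ : 0 ≤ β) (hβn : β * (n + 1) < 1)
    (hγ : 0 ≤ γ) (hβγ : β + γ < 1) (hR : 1 ≤ R) :
    ∃ C : ENNReal, C ≠ ⊤ ∧ ∀ c : ℂ, ‖c‖ ≤ R →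
      ∫⁻ z in Metric.ball (0 : ℂ) 1, ‖z ^ (n + 1) + c‖ₑ ^ (-(2 * (β + γ))) ≤
        C * ‖c‖ₑ ^ (-(2 * γ)) := by
  obtain ⟨K, A, hK, hA0, hA, h⟩ := exists_root_rpow_mul_rpow_le n hβ hβn hγ hβγ hR
  set J := ∫⁻ z in Metric.ball (0 : ℂ) (1 + R), ‖z‖ₑ ^ (-(2 * A)) with hJ
  have hJtop : J < ⊤ := lintegral_ball_enorm_rpow_lt_top hA _
  refine ⟨(n + 1 : ℕ) * ((ENNReal.ofReal K)⁻¹ * J), ?_, fun c hc => ?_⟩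
  · exact ENNReal.mul_ne_top (ENNReal.natCast_ne_top _)
      (ENNReal.mul_ne_top (by simpa using hK) hJtop.ne)
  set S := Polynomial.nthRootsFinset (n + 1) (-c) with hS
  have hpt (z : ℂ) : ‖z ^ (n + 1) + c‖ₑ ^ (-(2 * (β + γ))) ≤
      ∑ b ∈ S, (ENNReal.ofReal K)⁻¹ * ‖z - b‖ₑ ^ (-(2 * A)) * ‖c‖ₑ ^ (-(2 * γ)) := by
    obtain ⟨b, hb, hle⟩ := h c z hc
    have hbS : b ∈ S := (Polynomial.mem_nthRootsFinset n.succ_pos _).2 hb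
    refine le_trans ?_ (Finset.single_le_sum (f := fun b =>
      (ENNReal.ofReal K)⁻¹ * ‖z - b‖ₑ ^ (-(2 * A)) * ‖c‖ₑ ^ (-(2 * γ)))
      (fun _ _ => zero_le) hbS)
    have hle' := ENNReal.ofReal_le_ofReal hle
    rw [ENNReal.ofReal_mul (by positivity), ENNReal.ofReal_mul (by positivity),
      ← ENNReal.ofReal_rpow_of_nonneg (norm_nonneg _) (by positivity),
      ← ENNReal.ofReal_rpow_of_nonneg (norm_nonneg _) (by positivity),
      ← ENNReal.ofReal_rpow_of_nonneg (norm_nonneg _) (by positivity), ofReal_norm, ofReal_norm,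
      ofReal_norm] at hle'
    simp only [ENNReal.rpow_neg]
    rw [← ENNReal.mul_inv (.inl (by simpa using hK)) (.inl ENNReal.ofReal_ne_top),
      ← ENNReal.mul_inv]
    · exact ENNReal.inv_le_inv.2 hle'
    · exact .inr (ENNReal.rpow_ne_top_of_nonneg (by positivity) enorm_ne_top)
    · exact .inl (ENNReal.mul_ne_top ENNReal.ofReal_ne_top
        (ENNReal.rpow_ne_top_of_nonneg (by positivity) enorm_ne_top))
  have hbound (b : ℂ) (hb : b ∈ S) :
      ∫⁻ z in Metric.ball (0 : ℂ) 1, ‖z - b‖ₑ ^ (-(2 * A)) ≤ J := by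
    have hbR : ‖b‖ ≤ R := by
      rw [hS, Polynomial.mem_nthRootsFinset n.succ_pos] at hb
      by_contra! hlt
      have h1 : ‖b‖ ^ (n + 1) = ‖c‖ := by rw [← norm_pow, hb, norm_neg]
      have h2 : ‖b‖ ≤ ‖b‖ ^ (n + 1) := le_self_pow₀ (by linarith) n.succ_ne_zero
      linarith
    have hpre : Metric.ball (0 : ℂ) 1 ⊆ (fun z => z - b) ⁻¹' Metric.ball 0 (1 + R) := by
      intro z hz
      simp only [Set.mem_preimage, mem_ball_zero_iff] at hz ⊢
      linarith [norm_sub_le z b]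
    calc _ ≤ ∫⁻ z in (fun z => z - b) ⁻¹' Metric.ball 0 (1 + R), ‖z - b‖ₑ ^ (-(2 * A)) :=
          lintegral_mono_set hpre
      _ = J := (measurePreserving_sub_right volume b).setLIntegral_comp_preimage
          measurableSet_ball
          (f := fun z : ℂ => ‖z‖ₑ ^ (-(2 * A))) (by fun_prop)
  calc _ ≤ ∫⁻ z in Metric.ball (0 : ℂ) 1,
        ∑ b ∈ S, (ENNReal.ofReal K)⁻¹ * ‖z - b‖ₑ ^ (-(2 * A)) * ‖c‖ₑ ^ (-(2 * γ)) :=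
        lintegral_mono hpt
    _ = ∑ b ∈ S, (ENNReal.ofReal K)⁻¹ * (∫⁻ z in Metric.ball (0 : ℂ) 1, ‖z - b‖ₑ ^ (-(2 * A))) *
          ‖c‖ₑ ^ (-(2 * γ)) := by
        rw [lintegral_finsetSum]
        swap
        · exact fun b _ => Measurable.mul_const (Measurable.const_mul (by fun_prop) _) _
        refine Finset.sum_congr rfl fun b _ => ?_
        have hmeas : Measurable fun z : ℂ => ‖z - b‖ₑ ^ (-(2 * A)) := by fun_prop
        rw [lintegral_mul_const _ (hmeas.const_mul _), lintegral_const_mul _ hmeas]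
    _ ≤ ∑ b ∈ S, (ENNReal.ofReal K)⁻¹ * J * ‖c‖ₑ ^ (-(2 * γ)) := by
        gcongr with b hb
        exact hbound b hb
    _ = S.card * ((ENNReal.ofReal K)⁻¹ * J * ‖c‖ₑ ^ (-(2 * γ))) := by
        rw [Finset.sum_const, nsmul_eq_mul]
    _ ≤ (n + 1 : ℕ) * ((ENNReal.ofReal K)⁻¹ * J * ‖c‖ₑ ^ (-(2 * γ))) := by
        gcongr
        rw [hS, Polynomial.nthRootsFinset]
        exact (Multiset.toFinset_card_le _).trans (Polynomial.card_nthRoots _ _)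
    _ = _ := by ring

lemma lintegral_pi_fin_succ {n : ℕ} (μ : Measure ℂ) [SigmaFinite μ]
    {F : (Fin (n + 1) → ℂ) → ENNReal} (hF : Measurable F) :
    ∫⁻ z, F z ∂Measure.pi (fun _ => μ) =
      ∫⁻ w, ∫⁻ x, F (Fin.cons x w) ∂μ ∂Measure.pi (fun _ : Fin n => μ) := by
  have h := (measurePreserving_piFinSuccAbove (fun _ : Fin (n + 1) => μ) 0).symm
  rw [← h.lintegral_comp hF]
  refine (lintegral_prod_symm' (μ := μ) (ν := Measure.pi fun _ => μ)
    (fun p : ℂ × (Fin n → ℂ) => F ((MeasurableEquiv.piFinSuccAbove (fun _ => ℂ) 0).symm p))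
    (hF.comp (MeasurableEquiv.measurable _))).trans ?_
  simp [MeasurableEquiv.piFinSuccAbove, Fin.insertNthEquiv]

lemma exists_lintegral_sum_pow_add_le (n : ℕ) (m : Fin n → ℕ) (hm : ∀ j, m j ≠ 0)
    (β : Fin n → ℝ) (hβ : ∀ j, 0 ≤ β j) (hβm : ∀ j, β j * m j < 1) {γ R : ℝ} (hγ : 0 ≤ γ)
    (hβγ : ∑ j, β j + γ < 1) (hR : 1 ≤ R) :
    ∃ C : ENNReal, C ≠ ⊤ ∧ ∀ c : ℂ, ‖c‖ ≤ R →
      ∫⁻ z, ‖∑ j, z j ^ m j + c‖ₑ ^ (-(2 * (∑ j, β j + γ)))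
        ∂Measure.pi (fun _ => volume.restrict (Metric.ball (0 : ℂ) 1)) ≤
        C * ‖c‖ₑ ^ (-(2 * γ)) := by
  induction n with
  | zero => exact ⟨1, ENNReal.one_ne_top, fun c _ => by simp⟩
  | succ n ih =>
    obtain ⟨k, hk⟩ := Nat.exists_eq_succ_of_ne_zero (hm 0)
    have hβ' : 0 ≤ ∑ j : Fin n, β j.succ := Finset.sum_nonneg fun j _ => hβ _
    rw [Fin.sum_univ_succ] at hβγ
    obtain ⟨C, hC, hCle⟩ := ih (fun j => m j.succ) (fun j => hm _) (fun j => β j.succ)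
      (fun j => hβ _) (fun j => hβm _) (by linarith [hβ 0])
    obtain ⟨D, hD, hDle⟩ := exists_setLIntegral_pow_add_le k (hβ 0)
      (by simpa [hk] using hβm 0) (γ := ∑ j : Fin n, β j.succ + γ) (by positivity)
      (by linarith) (R := n + R) (by linarith [n.cast_nonneg (α := ℝ)])
    refine ⟨D * C, ENNReal.mul_ne_top hD hC, fun c hc => ?_⟩
    rw [lintegral_pi_fin_succ _ (by fun_prop), mul_assoc]
    refine le_trans ?_ (mul_le_mul_right (hCle c hc) D)
    rw [← lintegral_const_mul _ (by fun_prop)]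
    refine lintegral_mono_ae ?_
    rw [← Measure.restrict_pi_pi]
    filter_upwards [ae_restrict_mem (MeasurableSet.univ_pi fun _ => measurableSet_ball)] with w hw
    have hbd : ‖∑ j, w j ^ m j.succ + c‖ ≤ n + R := by
      refine (norm_add_le _ _).trans (add_le_add ?_ hc)
      calc ‖∑ j, w j ^ m j.succ‖ ≤ ∑ _j : Fin n, (1 : ℝ) := by
            refine norm_sum_le_of_le _ fun j _ => ?_
            have := hw j (Set.mem_univ _)
            rw [mem_ball_zero_iff] at this
            rw [norm_pow]
            exact pow_le_one₀ (norm_nonneg _) this.le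
        _ = n := by simp
    have h1 (x : ℂ) : ∑ j, (Fin.cons x w : Fin (n + 1) → ℂ) j ^ m j + c =
        x ^ (k + 1) + (∑ j, w j ^ m j.succ + c) := by
      rw [Fin.sum_univ_succ, hk, add_assoc]
      rfl
    simp only [h1, Fin.sum_univ_succ β, add_assoc]
    exact hDle _ hbd

lemma lintegral_sum_pow_lt_top {d : ℕ} {m : Fin d → ℕ} (hm : ∀ j, m j ≠ 0) {α : ℝ} (hα : 0 ≤ α)
    (hα1 : α < 1) (hαs : α < ∑ j, 1 / (m j : ℝ)) :
    ∫⁻ z : Fin d → ℂ in Set.univ.pi (fun _ => Metric.ball 0 1), ‖∑ j, z j ^ m j‖ₑ ^ (-(2 * α)) < ⊤ := by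
  set s := ∑ j, 1 / (m j : ℝ) with hs
  have hs0 : 0 < s := hα.trans_lt hαs
  have hsum : ∑ j, α / s * (1 / (m j : ℝ)) = α := by
    rw [← Finset.mul_sum, ← hs, div_mul_cancel₀ _ hs0.ne']
  obtain ⟨C, hC, h⟩ := exists_lintegral_sum_pow_add_le d m hm (fun j => α / s * (1 / (m j : ℝ)))
    (fun j => by positivity) (fun j => by
      have : (m j : ℝ) ≠ 0 := Nat.cast_ne_zero.2 (hm j)
      rw [mul_assoc, one_div_mul_cancel this, mul_one]
      exact (div_lt_one hs0).2 hαs) le_rfl (by rw [hsum]; linarith) le_rfl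
  rw [volume_pi, Measure.restrict_pi_pi]
  refine lt_of_le_of_lt ?_ hC.lt_top
  have h0 := h 0 (by simp)
  rw [hsum] at h0
  simpa using h0

lemma lintegral_enorm_rpow_neg_eq_top {X : Type*} [MeasurableSpace X] {μ : Measure X} {f : X → ℂ}
    (hf : Measurable f) {α : ℝ} (hα : 0 < α) {c : ENNReal} (hc : c ≠ 0)
    (h : ∀ᶠ ε : ℝ in 𝓝[>] 0,
      c * ENNReal.ofReal ε ^ (2 * α) ≤ μ {x | ‖f x‖ₑ < ENNReal.ofReal ε}) :
    ∫⁻ x, ‖f x‖ₑ ^ (-(2 * α)) ∂μ = ⊤ := by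
  by_contra hfin
  have hmarkov (ε : ℝ) : (ENNReal.ofReal ε ^ (2 * α))⁻¹ * μ {x | ‖f x‖ₑ < ENNReal.ofReal ε} ≤
      ∫⁻ x in {x | ‖f x‖ₑ < ENNReal.ofReal ε}, ‖f x‖ₑ ^ (-(2 * α)) ∂μ := by
    rw [← setLIntegral_const]
    refine setLIntegral_mono (by fun_prop) fun x hx => ?_
    rw [ENNReal.rpow_neg]
    exact ENNReal.inv_le_inv.2 (ENNReal.rpow_le_rpow (le_of_lt hx) (by positivity))
  have hpos : ∀ᶠ ε : ℝ in 𝓝[>] 0,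
      ENNReal.ofReal ε ^ (2 * α) ≠ 0 ∧ ENNReal.ofReal ε ^ (2 * α) ≠ ⊤ := by
    filter_upwards [self_mem_nhdsWithin] with ε hε
    exact ⟨(ENNReal.rpow_pos (ENNReal.ofReal_pos.2 hε) ENNReal.ofReal_ne_top).ne',
      ENNReal.rpow_ne_top_of_nonneg (by positivity) ENNReal.ofReal_ne_top⟩
  have hlim : Tendsto (fun ε : ℝ => ENNReal.ofReal ε ^ (2 * α) *
      ∫⁻ x, ‖f x‖ₑ ^ (-(2 * α)) ∂μ) (𝓝[>] 0) (𝓝 0) := by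
    have h0 : Tendsto (fun ε : ℝ => ENNReal.ofReal ε ^ (2 * α)) (𝓝[>] 0) (𝓝 0) := by
      have : Continuous fun ε : ℝ => ENNReal.ofReal ε ^ (2 * α) :=
        ENNReal.continuous_rpow_const.comp ENNReal.continuous_ofReal
      have h1 := this.tendsto 0
      rw [ENNReal.ofReal_zero, ENNReal.zero_rpow_of_pos (by positivity)] at h1
      exact h1.mono_left nhdsWithin_le_nhds
    simpa using ENNReal.Tendsto.mul_const h0 (.inr hfin)
  have hmeas : Tendsto (μ ∘ fun ε : ℝ => {x | ‖f x‖ₑ < ENNReal.ofReal ε}) (𝓝[>] 0) (𝓝 0) := by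
    refine tendsto_of_tendsto_of_tendsto_of_le_of_le' tendsto_const_nhds hlim
      (.of_forall fun _ => zero_le) ?_
    filter_upwards [hpos] with ε hε
    have h1 := (hmarkov ε).trans (setLIntegral_le_lintegral _ _)
    rwa [mul_comm, ← ENNReal.div_eq_inv_mul.trans (mul_comm _ _),
      ENNReal.div_le_iff hε.1 hε.2, mul_comm] at h1
  refine hc (le_antisymm (ge_of_tendsto (tendsto_setLIntegral_zero hfin hmeas) ?_) zero_le)
  filter_upwards [h, hpos] with ε hle hε
  refine le_trans ?_ (hmarkov ε)
  rwa [← ENNReal.div_eq_inv_mul, ENNReal.le_div_iff_mul_le (.inl hε.1) (.inl hε.2)]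

lemma norm_pow_sub_pow_le_of_norm_le_one {x a : ℂ} (hx : ‖x‖ ≤ 1) (ha : ‖a‖ ≤ 1) (k : ℕ) :
    ‖x ^ k - a ^ k‖ ≤ k * ‖x - a‖ := by
  induction k with
  | zero => simp
  | succ k ih =>
    rw [show x ^ (k + 1) - a ^ (k + 1) = x ^ k * (x - a) + (x ^ k - a ^ k) * a by ring]
    refine (norm_add_le _ _).trans ?_
    rw [norm_mul, norm_mul, norm_pow]
    have h1 := pow_le_one₀ (n := k) (norm_nonneg _) hx
    push_cast
    nlinarith [norm_nonneg (x - a), norm_nonneg (x ^ k - a ^ k)]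

lemma exists_mul_sq_le_volume_sublevel {d : ℕ} (hd : 1 ≤ d) {m : Fin d → ℕ} (hm : ∀ j, m j ≠ 0)
    {δ : ℝ} (hδ : 0 < δ) (hδ1 : δ ≤ 1) :
    ∃ c : ENNReal, c ≠ 0 ∧ ∀ᶠ ε : ℝ in 𝓝[>] 0, c * ENNReal.ofReal ε ^ (2 : ℝ) ≤
      volume.restrict (Set.univ.pi fun _ => Metric.ball 0 δ)
        {z : Fin d → ℂ | ‖∑ j, z j ^ m j‖ₑ < ENNReal.ofReal ε} := by
  obtain ⟨n, rfl⟩ := Nat.exists_eq_add_of_le' hd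
  set k := m 0 with hk
  have hk0 : (0 : ℝ) < k := Nat.cast_pos.2 (Nat.pos_of_ne_zero (hm 0))
  have hk1 : (1 : ℝ) ≤ k := Nat.one_le_cast.2 (Nat.one_le_iff_ne_zero.2 (hm 0))
  set μ : Measure ℂ := volume.restrict (Metric.ball 0 δ) with hμ
  set ρ : ℝ := (δ / 2) ^ k / (n + 1) with hρ
  have hρ0 : 0 < ρ := by positivity
  have hρδ : ρ ≤ δ := by
    rw [hρ]
    calc (δ / 2) ^ k / (n + 1) ≤ (δ / 2) ^ k :=
          div_le_self (by positivity) (by linarith [n.cast_nonneg (α := ℝ)])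
      _ ≤ δ / 2 := pow_le_of_le_one (by positivity) (by linarith) (hm 0)
      _ ≤ δ := by linarith
  set P : Set (Fin n → ℂ) := Set.univ.pi fun _ => Metric.ball 0 ρ with hP
  have hPpos : Measure.pi (fun _ : Fin n => μ) P ≠ 0 := by
    rw [hP, Measure.pi_pi]
    refine Finset.prod_ne_zero_iff.2 fun _ _ => ?_
    rw [hμ, Measure.restrict_apply measurableSet_ball,
      Set.inter_eq_left.2 (Metric.ball_subset_ball hρδ)]
    exact (Metric.measure_ball_pos _ _ hρ0).ne'
  refine ⟨ENNReal.ofReal (1 / k) ^ (2 : ℝ) * NNReal.pi * Measure.pi (fun _ : Fin n => μ) P,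
    ?_, ?_⟩
  · refine mul_ne_zero (mul_ne_zero ?_ (by simp [NNReal.pi_ne_zero])) hPpos
    exact (ENNReal.rpow_pos (ENNReal.ofReal_pos.2 (by positivity)) ENNReal.ofReal_ne_top).ne'
  filter_upwards [Ioo_mem_nhdsGT (half_pos hδ)] with ε hε
  have hS : MeasurableSet {z : Fin (n + 1) → ℂ | ‖∑ j, z j ^ m j‖ₑ < ENNReal.ofReal ε} :=
    measurableSet_lt (by fun_prop) measurable_const
  rw [volume_pi, Measure.restrict_pi_pi, ← lintegral_indicator_one hS,
    lintegral_pi_fin_succ _ (measurable_one.indicator hS)]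
  calc _ = ∫⁻ _ in P, ENNReal.ofReal (ε / k) ^ 2 * NNReal.pi
            ∂Measure.pi (fun _ : Fin n => μ) := by
        rw [setLIntegral_const, div_eq_mul_one_div ε, ENNReal.ofReal_mul hε.1.le,
          ← ENNReal.rpow_two, ENNReal.mul_rpow_of_nonneg _ _ zero_le_two]
        ring
    _ ≤ ∫⁻ w in P, ∫⁻ x, Set.indicator
            {z : Fin (n + 1) → ℂ | ‖∑ j, z j ^ m j‖ₑ < ENNReal.ofReal ε} 1 (Fin.cons x w) ∂μ
            ∂Measure.pi (fun _ : Fin n => μ) := by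
        refine setLIntegral_mono' (MeasurableSet.univ_pi fun _ => measurableSet_ball)
          fun w hw => ?_
        obtain ⟨a, ha⟩ := IsAlgClosed.exists_pow_nat_eq (-∑ j, w j ^ m j.succ)
          (Nat.pos_of_ne_zero (hm 0))
        have haδ : ‖a‖ ≤ δ / 2 := by
          refine le_of_pow_le_pow_left₀ (hm 0) (by positivity) ?_
          rw [← norm_pow, ha, norm_neg]
          calc ‖∑ j, w j ^ m j.succ‖ ≤ ∑ _j : Fin n, ρ := by
                refine norm_sum_le_of_le _ fun j _ => ?_
                have := hw j (Set.mem_univ _)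
                rw [mem_ball_zero_iff] at this
                rw [norm_pow]
                exact (pow_le_of_le_one (norm_nonneg _) (by linarith) (hm _)).trans this.le
            _ = n * ρ := by simp
            _ ≤ (δ / 2) ^ k := by
                rw [hρ, mul_div_assoc', div_le_iff₀ (by positivity)]
                nlinarith [pow_pos (half_pos hδ) k]
        have hεk : ε / k ≤ δ / 2 := (div_le_self hε.1.le hk1).trans hε.2.le
        have hsub : Metric.ball a (ε / k) ⊆ Metric.ball 0 δ := by
          refine Metric.ball_subset_ball' ?_
          rw [dist_zero_right]
          linarith
        calc ENNReal.ofReal (ε / k) ^ 2 * NNReal.pi = μ (Metric.ball a (ε / k)) := by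
              rw [hμ, Measure.restrict_apply measurableSet_ball, Set.inter_eq_left.2 hsub,
                Complex.volume_ball]
          _ = ∫⁻ x, (Metric.ball a (ε / k)).indicator (1 : ℂ → ENNReal) x ∂μ :=
              (lintegral_indicator_one measurableSet_ball).symm
          _ ≤ _ := by
              refine lintegral_mono fun y => ?_
              by_cases hy : y ∈ Metric.ball a (ε / k)
              swap
              · rw [Set.indicator_of_notMem hy]
                exact zero_le
              have hy1 : ‖y‖ ≤ 1 := (mem_ball_zero_iff.1 (hsub hy)).le.trans hδ1
              have h1 : ∑ j, (Fin.cons y w : Fin (n + 1) → ℂ) j ^ m j = y ^ k - a ^ k := by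
                rw [Fin.sum_univ_succ, ha, sub_neg_eq_add]
                rfl
              have h2 : ‖y ^ k - a ^ k‖ < ε := by
                refine (norm_pow_sub_pow_le_of_norm_le_one hy1 (by linarith) k).trans_lt ?_
                rw [mul_comm, ← lt_div_iff₀ hk0]
                simpa [dist_eq_norm] using hy
              rw [Set.indicator_of_mem hy, Set.indicator_of_mem]
              · rfl
              rw [Set.mem_ofPred_eq, h1, ← ofReal_norm, ENNReal.ofReal_lt_ofReal_iff hε.1]
              exact h2
    _ ≤ _ := setLIntegral_le_lintegral _ _

lemma exists_mul_rpow_le_volume_sublevel {d : ℕ} (hd : 1 ≤ d) {m : Fin d → ℕ}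
    (hm : ∀ j, m j ≠ 0) {δ : ℝ} (hδ : 0 < δ) (hδ1 : δ ≤ 1) :
    ∃ c : ENNReal, c ≠ 0 ∧ ∀ᶠ ε : ℝ in 𝓝[>] 0,
      c * ENNReal.ofReal ε ^ (2 * ∑ j, 1 / (m j : ℝ)) ≤
        volume.restrict (Set.univ.pi fun _ => Metric.ball 0 δ)
          {z : Fin d → ℂ | ‖∑ j, z j ^ m j‖ₑ < ENNReal.ofReal ε} := by
  have hd0 : (0 : ℝ) < d := Nat.cast_pos.2 hd
  have hd1 : (1 : ℝ) ≤ d := Nat.one_le_cast.2 hd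
  have hm0 (j : Fin d) : (m j : ℝ) ≠ 0 := Nat.cast_ne_zero.2 (hm j)
  refine ⟨∏ j, ENNReal.ofReal (δ * (1 / d) ^ (1 / (m j : ℝ))) ^ 2 * NNReal.pi, ?_, ?_⟩
  · refine Finset.prod_ne_zero_iff.2 fun j _ => mul_ne_zero (pow_ne_zero _ ?_)
      (by simp [NNReal.pi_ne_zero])
    exact (ENNReal.ofReal_pos.2 (by positivity)).ne'
  filter_upwards [Ioo_mem_nhdsGT one_pos] with ε hε
  have hε0 : 0 < ε := hε.1
  have hεd : ε / d ≤ 1 := (div_le_self hε0.le hd1).trans hε.2.le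
  have hsub : (Set.univ.pi fun j => Metric.ball 0 (δ * (ε / d) ^ (1 / (m j : ℝ)))) ⊆
      {z : Fin d → ℂ | ‖∑ j, z j ^ m j‖ₑ < ENNReal.ofReal ε} ∩
        Set.univ.pi fun _ => Metric.ball 0 δ := by
    intro z hz
    have hz' (j : Fin d) : ‖z j‖ < δ * (ε / d) ^ (1 / (m j : ℝ)) := by
      simpa using hz j (Set.mem_univ _)
    refine ⟨?_, fun j _ => ?_⟩
    · have : Nonempty (Fin d) := ⟨⟨0, hd⟩⟩
      rw [Set.mem_ofPred_eq, ← ofReal_norm, ENNReal.ofReal_lt_ofReal_iff hε0]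
      calc ‖∑ j, z j ^ m j‖ ≤ ∑ j, ‖z j ^ m j‖ := norm_sum_le _ _
        _ < ∑ _j : Fin d, ε / d := by
            refine Finset.sum_lt_sum_of_nonempty Finset.univ_nonempty fun j _ => ?_
            rw [norm_pow]
            calc ‖z j‖ ^ m j < (δ * (ε / d) ^ (1 / (m j : ℝ))) ^ m j :=
                  pow_lt_pow_left₀ (hz' j) (norm_nonneg _) (hm j)
              _ = δ ^ m j * (ε / d) := by
                  rw [mul_pow, ← Real.rpow_mul_natCast (by positivity),
                    one_div_mul_cancel (hm0 j), Real.rpow_one]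
              _ ≤ ε / d := mul_le_of_le_one_left (by positivity) (pow_le_one₀ hδ.le hδ1)
        _ = ε := by simp; field_simp
    · rw [mem_ball_zero_iff]
      exact (hz' j).trans_le (mul_le_of_le_one_right hδ.le
        (Real.rpow_le_one (by positivity) hεd (by positivity)))
  rw [Measure.restrict_apply (measurableSet_lt (by fun_prop) measurable_const)]
  refine le_trans (le_of_eq ?_) (measure_mono hsub)
  rw [volume_pi_pi, Finset.mul_sum, ENNReal.ofReal_rpow_of_pos hε0, Real.rpow_sum_of_pos hε0,
    ENNReal.ofReal_prod_of_nonneg fun j _ => by positivity, ← Finset.prod_mul_distrib]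
  refine Finset.prod_congr rfl fun j _ => ?_
  rw [Complex.volume_ball, div_eq_mul_one_div ε, Real.mul_rpow hε0.le (by positivity),
    mul_left_comm, ENNReal.ofReal_mul (p := ε ^ _) (by positivity), mul_pow,
    ← ENNReal.ofReal_rpow_of_pos hε0, ← ENNReal.ofReal_rpow_of_pos hε0,
    mul_comm 2 (1 / (m j : ℝ)), ENNReal.rpow_mul, ENNReal.rpow_two]
  ring

lemma enorm_one_div_rpow_le (w : ℂ) {t : ℝ} (ht : 0 ≤ t) :
    ‖‖(1 : ℂ)‖ ^ 2 / ‖w‖ ^ t‖ₑ ≤ ‖w‖ₑ ^ (-t) := by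
  rw [norm_one, one_pow, Real.enorm_of_nonneg (by positivity), ENNReal.rpow_neg, one_div,
    ← ofReal_norm, ENNReal.ofReal_rpow_of_nonneg (norm_nonneg _) ht]
  exact ENNReal.ofReal_inv_le

lemma enorm_one_div_rpow_eq {w : ℂ} (hw : w ≠ 0) (t : ℝ) :
    ‖‖(1 : ℂ)‖ ^ 2 / ‖w‖ ^ t‖ₑ = ‖w‖ₑ ^ (-t) := by
  have hw' : 0 < ‖w‖ := norm_pos_iff.2 hw
  rw [norm_one, one_pow, Real.enorm_of_nonneg (by positivity), one_div,
    ← Real.rpow_neg (norm_nonneg _), ← ENNReal.ofReal_rpow_of_pos hw', ofReal_norm]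

lemma ae_sum_pow_ne_zero {d : ℕ} (hd : 1 ≤ d) {m : Fin d → ℕ} (hm : ∀ j, m j ≠ 0) :
    ∀ᵐ z : Fin d → ℂ ∂volume.restrict (Set.univ.pi fun _ => Metric.ball 0 1),
      ∑ j, z j ^ m j ≠ 0 := by
  have : Nonempty (Fin d) := ⟨⟨0, hd⟩⟩
  have hs : 0 < ∑ j, 1 / (m j : ℝ) := Finset.sum_pos (fun j _ => by
    have : (0 : ℝ) < m j := Nat.cast_pos.2 (Nat.pos_of_ne_zero (hm j))
    positivity) Finset.univ_nonempty
  obtain ⟨α, hα0, hα⟩ := exists_between (lt_min one_pos hs)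
  have h := lintegral_sum_pow_lt_top hm hα0.le (hα.trans_le (min_le_left _ _))
    (hα.trans_le (min_le_right _ _))
  filter_upwards [ae_lt_top (by fun_prop) h.ne] with z hz h0
  rw [h0, enorm_zero, ENNReal.zero_rpow_of_neg (by linarith)] at hz
  exact lt_irrefl _ hz

lemma setLIntegral_sum_pow_eq_top {d : ℕ} (hd : 1 ≤ d) {m : Fin d → ℕ} (hm : ∀ j, m j ≠ 0)
    {α : ℝ} (hα0 : 0 < α) (hα : min 1 (∑ j, 1 / (m j : ℝ)) ≤ α) {δ : ℝ} (hδ : 0 < δ)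
    (hδ1 : δ ≤ 1) :
    ∫⁻ z : Fin d → ℂ in Set.univ.pi (fun _ => Metric.ball 0 δ),
      ‖∑ j, z j ^ m j‖ₑ ^ (-(2 * α)) = ⊤ := by
  obtain ⟨t, htα, c, hc, h⟩ : ∃ t ≤ α, ∃ c : ENNReal, c ≠ 0 ∧ ∀ᶠ ε : ℝ in 𝓝[>] 0,
      c * ENNReal.ofReal ε ^ (2 * t) ≤
        volume.restrict (Set.univ.pi fun _ => Metric.ball 0 δ)
          {z : Fin d → ℂ | ‖∑ j, z j ^ m j‖ₑ < ENNReal.ofReal ε} := by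
    rcases min_le_iff.1 hα with h | h
    · exact ⟨1, h, by simpa using exists_mul_sq_le_volume_sublevel hd hm hδ hδ1⟩
    · exact ⟨_, h, exists_mul_rpow_le_volume_sublevel hd hm hδ hδ1⟩
  refine lintegral_enorm_rpow_neg_eq_top (by fun_prop) hα0 hc ?_
  filter_upwards [h, Ioo_mem_nhdsGT one_pos] with ε hε hε1
  refine le_trans ?_ hε
  gcongr c * ?_
  exact ENNReal.rpow_le_rpow_of_exponent_ge (by simpa using hε1.2.le) (by linarith)

lemma multCond_sum_pow_iff {d : ℕ} (hd : 1 ≤ d) {m : Fin d → ℕ} (hm : ∀ j, m j ≠ 0)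
    {α : ℝ} (hα : 0 ≤ α) :
    MultCond (fun z : Fin d → ℂ => ∑ j, z j ^ m j) Set.univ (fun _ => 1) 0 α ↔
      α < min 1 (∑ j, 1 / (m j : ℝ)) := by
  have : Nonempty (Fin d) := ⟨⟨0, hd⟩⟩
  have hs : 0 < ∑ j, 1 / (m j : ℝ) := Finset.sum_pos (fun j _ => by
    have : (0 : ℝ) < m j := Nat.cast_pos.2 (Nat.pos_of_ne_zero (hm j))
    positivity) Finset.univ_nonempty
  constructor
  · rintro ⟨V, hV, h0, -, -, hbound⟩
    by_contra! hle
    have hα0 : 0 < α := (lt_min one_pos hs).trans_le hle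
    obtain ⟨r, hr, hrV⟩ := Metric.isOpen_iff.1 hV 0 h0
    set δ := min r 1
    have hδ : 0 < δ := lt_min hr one_pos
    have hsub : (Set.univ.pi fun _ : Fin d => Metric.ball (0 : ℂ) δ) ⊆ V := by
      refine (Set.Subset.trans ?_ (Metric.ball_subset_ball (min_le_left r 1))).trans hrV
      exact (ball_pi (0 : Fin d → ℂ) hδ).ge
    have hne : ∀ᵐ z : Fin d → ℂ ∂volume.restrict (Set.univ.pi fun _ => Metric.ball 0 δ),
        ∑ j, z j ^ m j ≠ 0 :=
      ae_restrict_of_ae_restrict_of_subset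
        (Set.pi_mono fun _ _ => Metric.ball_subset_ball (min_le_right r 1))
        (ae_sum_pow_ne_zero hd hm)
    have hfin := (hbound.mono_set hsub).2
    rw [HasFiniteIntegral, lintegral_congr_ae
      (hne.mono fun z hz => enorm_one_div_rpow_eq hz (2 * α)),
      setLIntegral_sum_pow_eq_top hd hm hα0 hle hδ (min_le_right r 1)] at hfin
    exact lt_irrefl _ hfin
  · intro hlt
    refine ⟨Set.univ.pi fun _ => Metric.ball 0 1,
      isOpen_set_pi Set.finite_univ fun _ _ => Metric.isOpen_ball, by simp [Set.mem_pi],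
      Set.subset_univ _, differentiableOn_const _, ?_, ?_⟩
    · exact Measurable.aestronglyMeasurable (by fun_prop)
    · refine lt_of_le_of_lt (lintegral_mono fun z => enorm_one_div_rpow_le _ (by positivity)) ?_
      exact lintegral_sum_pow_lt_top hm hα (hlt.trans_le (min_le_left _ _))
        (hlt.trans_le (min_le_right _ _))

/-- Formula (2.6.6): the log canonical threshold at the origin of the Brieskorn–Pham
polynomial `f = z₁^{m₁} + ⋯ + z_d^{m_d}` equals `min {1, Σⱼ 1/mⱼ}`; explicitly,
`|f|^{-2α}` is integrable near `0` iff `α < min {1, Σⱼ 1/mⱼ}` (for `α ≥ 0`). -/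
theorem lct_brieskorn_pham
    (d : ℕ) (hd : 1 ≤ d) (m : Fin d → ℕ) (hm : ∀ j, 2 ≤ m j)
    (f : (Fin d → ℂ) → ℂ) (hf : f = fun z => ∑ j : Fin d, z j ^ m j) :
    (∀ α : ℝ, 0 ≤ α →
      (MultCond f Set.univ (fun _ => 1) 0 α ↔ α < min 1 (∑ j : Fin d, 1 / (m j : ℝ)))) ∧
    Lct f Set.univ 0 = min 1 (∑ j : Fin d, 1 / (m j : ℝ)) := by
  subst hf
  have hm0 (j : Fin d) : m j ≠ 0 := by have := hm j; omega
  have : Nonempty (Fin d) := ⟨⟨0, hd⟩⟩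
  have hs : 0 < min 1 (∑ j : Fin d, 1 / (m j : ℝ)) := lt_min one_pos <|
    Finset.sum_pos (fun j _ => by
      have : (0 : ℝ) < m j := Nat.cast_pos.2 (Nat.pos_of_ne_zero (hm0 j))
      positivity) Finset.univ_nonempty
  refine ⟨fun α hα => multCond_sum_pow_iff hd hm0 hα, ?_⟩
  rw [Lct, ← csSup_Ico hs]
  congr 1
  ext α
  exact and_congr_right fun hα => multCond_sum_pow_iff hd hm0 hα
end
end
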